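/- (Decrease of the L¹ norm.) Let d ≥ 1, T > 0, ε ≥ 0, and let f : ℝ → ℝ be continuously differentiable with f(0) = 0. Let W : [0,T] × ℝ^d → ℝ^d be continuous, continuously differentiable in x, with W bounded and div_x W bounded and continuous. Let u : [0,T] × ℝ^d → ℝ be continuous, continuously differentiable in t and twice continuously differentiable in x, satisfying pointwise on (0,T)×ℝ^d: ∂_t u + f′(u)·∇_x u·W + f(u)·div_x W = ε·Δ_x u; assume moreover u is bounded and there is an integrable function g : ℝ^d → [0,∞) with |u(t,x)| + ‖∇_x u(t,x)‖ + |Δ_x u(t,x)| ≤ g(x) for all (t,x). Then the map t ↦ ∫_{ℝ^d} |u(t,x)| dx is nonincreasing on [0,T]. -/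

import Mathlib

open MeasureTheory Real
open scoped RealInnerProductSpace

noncomputable section

/-- `d`-dimensional Euclidean space. -/
abbrev Euc (d : ℕ) := EuclideanSpace ℝ (Fin d)

/-- Divergence of a vector field on `ℝ^d`. -/
def diverg {d : ℕ} (V : Euc d → Euc d) (x : Euc d) : ℝ :=
  ∑ i, ⟪fderiv ℝ V x (EuclideanSpace.single i 1), EuclideanSpace.single i (1:ℝ)⟫

/-- Laplacian of a scalar function on `ℝ^d`. -/
def lap {d : ℕ} (u : Euc d → ℝ) (x : Euc d) : ℝ :=
  ∑ i, fderiv ℝ (fun y => fderiv ℝ u y (EuclideanSpace.single i 1)) x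
    (EuclideanSpace.single i 1)

lemma Euc.sum_apply_smul_single {d : ℕ} (v : Euc d) :
    ∑ i, v i • (EuclideanSpace.single i 1 : Euc d) = v := by
  simpa using (EuclideanSpace.basisFun (Fin d) ℝ).sum_repr v

lemma Euc.sum_clm_single_mul {d : ℕ} (A : Euc d →L[ℝ] ℝ) (v : Euc d) :
    ∑ i, A (EuclideanSpace.single i 1) * v i = A v := by
  conv_rhs => rw [← Euc.sum_apply_smul_single v]
  simp [mul_comm]

lemma diverg_eq_sum_apply {d : ℕ} (V : Euc d → Euc d) (x : Euc d) :
    diverg V x = ∑ i, (fderiv ℝ V x (EuclideanSpace.single i 1)) i := by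
  simp [diverg, EuclideanSpace.inner_single_right]

lemma diverg_add {d : ℕ} {V U : Euc d → Euc d} {x : Euc d} (hV : DifferentiableAt ℝ V x)
    (hU : DifferentiableAt ℝ U x) :
    diverg (fun y => V y + U y) x = diverg V x + diverg U x := by
  simp [diverg_eq_sum_apply, fderiv_fun_add hV hU, Finset.sum_add_distrib]

lemma diverg_smul {d : ℕ} {a : Euc d → ℝ} {V : Euc d → Euc d} {x : Euc d}
    (ha : DifferentiableAt ℝ a x) (hV : DifferentiableAt ℝ V x) :
    diverg (fun y => a y • V y) x = fderiv ℝ a x (V x) + a x * diverg V x := by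
  simp only [diverg_eq_sum_apply, fderiv_fun_smul ha hV]
  rw [← Euc.sum_clm_single_mul (fderiv ℝ a x) (V x), Finset.mul_sum, ← Finset.sum_add_distrib]
  refine Finset.sum_congr rfl fun i _ => ?_
  simp [add_comm]

lemma continuous_diverg {d : ℕ} {V : Euc d → Euc d} (hV : ContDiff ℝ 1 V) :
    Continuous (diverg V) := by
  have := hV.continuous_fderiv one_ne_zero
  unfold diverg
  fun_prop

lemma contDiff_gradient {d : ℕ} {v : Euc d → ℝ} (hv : ContDiff ℝ 2 v) :
    ContDiff ℝ 1 (gradient v) :=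
  (InnerProductSpace.toDual ℝ (Euc d)).symm.contDiff.comp
    (hv.fderiv_right (m := 1) (by norm_num))

lemma diverg_gradient {d : ℕ} {v : Euc d → ℝ} (hv : ContDiff ℝ 2 v) (x : Euc d) :
    diverg (gradient v) x = lap v x := by
  refine Finset.sum_congr rfl fun i _ => ?_
  have hd : DifferentiableAt ℝ (gradient v) x :=
    (contDiff_gradient hv).differentiable one_ne_zero x
  have heq : (fun y => fderiv ℝ v y (EuclideanSpace.single i 1)) =
      fun y => ⟪gradient v y, EuclideanSpace.single i (1:ℝ)⟫ :=
    funext fun y => (inner_gradient_left).symm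
  rw [heq, fderiv_inner_apply ℝ hd (by fun_prop)]
  simp

/-- Integration by parts against a compactly supported test function. -/
lemma integral_mul_diverg_eq_neg {d : ℕ} {φ : Euc d → ℝ} {V : Euc d → Euc d}
    (hφ : ContDiff ℝ 1 φ) (hφc : HasCompactSupport φ) (hV : ContDiff ℝ 1 V) :
    ∫ x, φ x * diverg V x = -∫ x, fderiv ℝ φ x (V x) := by
  have hφ' := hφ.continuous_fderiv one_ne_zero
  have hV' := hV.continuous_fderiv one_ne_zero
  have hVi : ∀ i, ContDiff ℝ 1 (fun x => V x i) := fun i => by fun_prop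
  have hVi' : ∀ i, Continuous (fderiv ℝ (fun x => V x i)) := fun i =>
    (hVi i).continuous_fderiv one_ne_zero
  have hφcd : ∀ i : Fin d, HasCompactSupport
      (fun x => fderiv ℝ φ x (EuclideanSpace.single i 1)) :=
    fun i => hφc.fderiv_apply ℝ _
  have h1 : ∀ i : Fin d, Integrable
      (fun x => fderiv ℝ φ x (EuclideanSpace.single i 1) * V x i) := fun i =>
    (((hφ'.clm_apply continuous_const).mul
      (hVi i).continuous).integrable_of_hasCompactSupport (hφcd i).mul_right)
  have h2 : ∀ i : Fin d, Integrable
      (fun x => φ x * fderiv ℝ (fun x => V x i) x (EuclideanSpace.single i 1)) := fun i =>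
    ((hφ.continuous.mul ((hVi' i).clm_apply continuous_const)).integrable_of_hasCompactSupport
      hφc.mul_right)
  have h3 : ∀ i : Fin d, Integrable (fun x => φ x * V x i) := fun i =>
    ((hφ.continuous.mul (hVi i).continuous).integrable_of_hasCompactSupport hφc.mul_right)
  have hL : ∀ x, φ x * diverg V x =
      ∑ i, φ x * fderiv ℝ (fun x => V x i) x (EuclideanSpace.single i 1) := by
    intro x
    rw [diverg_eq_sum_apply, Finset.mul_sum]
    refine Finset.sum_congr rfl fun i _ => ?_
    congr 1
    have hdx : HasFDerivAt V (fderiv ℝ V x) x :=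
      (hV.differentiable one_ne_zero x).hasFDerivAt
    have := ((EuclideanSpace.proj (𝕜 := ℝ) i).hasFDerivAt (x := V x)).comp x hdx
    have h' := this.fderiv
    have h'' : (fun x => V x i) = ⇑(EuclideanSpace.proj (𝕜 := ℝ) i) ∘ V := rfl
    rw [h'', h']
    simp
  have hR : ∀ x, fderiv ℝ φ x (V x) =
      ∑ i, fderiv ℝ φ x (EuclideanSpace.single i 1) * V x i := fun x =>
    (Euc.sum_clm_single_mul _ _).symm
  simp_rw [hL, hR]
  rw [integral_finsetSum _ fun i _ => h2 i, integral_finsetSum _ fun i _ => h1 i,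
    ← Finset.sum_neg_distrib]
  refine Finset.sum_congr rfl fun i _ => ?_
  exact integral_mul_fderiv_eq_neg_fderiv_mul_of_integrable (h1 i) (h2 i) (h3 i)
    (fun x _ => hφ.differentiable one_ne_zero x)
    (fun x _ => (hVi i).differentiable one_ne_zero x)

/-- Smooth cutoffs exhausting `ℝ^d`, with gradients of order `1 / n`. -/
lemma exists_cutoff (d : ℕ) : ∃ (φ : ℕ → Euc d → ℝ) (C : ℝ),
    (∀ n, ContDiff ℝ 1 (φ n)) ∧ (∀ n, HasCompactSupport (φ n)) ∧
    (∀ n x, 0 ≤ φ n x) ∧ (∀ n x, φ n x ≤ 1) ∧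
    (∀ x, Filter.Tendsto (fun n => φ n x) Filter.atTop (nhds 1)) ∧
    (∀ n x, ‖fderiv ℝ (φ n) x‖ ≤ 1 / ((n : ℝ) + 1) * C) := by
  let ψ : ContDiffBump (0 : Euc d) := ⟨1, 2, one_pos, by norm_num⟩
  have hψ : ContDiff ℝ 1 ψ := ψ.contDiff
  obtain ⟨C, hC⟩ := (hψ.continuous_fderiv one_ne_zero).bounded_above_of_compact_support
    (ψ.hasCompactSupport.fderiv ℝ)
  have hlim : Filter.Tendsto (fun n : ℕ => (1 / ((n : ℝ) + 1))) Filter.atTop (nhds 0) :=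
    tendsto_one_div_add_atTop_nhds_zero_nat
  refine ⟨fun n x => ψ ((1 / ((n : ℝ) + 1)) • x), C, fun n => hψ.comp (by fun_prop), fun n => ?_,
    fun n x => ψ.nonneg, fun n x => ψ.le_one, fun x => ?_, fun n x => ?_⟩
  · exact ψ.hasCompactSupport.comp_smul (by positivity)
  · have h0 : ψ (0 : Euc d) = 1 := ψ.one_of_mem_closedBall (by simp [ψ])
    have h := (hψ.continuous.tendsto (0 : Euc d)).comp
      (by simpa using hlim.smul_const x :
        Filter.Tendsto (fun n : ℕ => (1 / ((n : ℝ) + 1)) • x) Filter.atTop (nhds 0))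
    rwa [h0] at h
  · rw [fderiv_comp_smul, norm_smul, Real.norm_of_nonneg (by positivity)]
    gcongr
    exact hC _

/-- Testing a divergence against `p ∘ v` costs at most the bulk term produced by the product rule:
the boundary terms at infinity vanish for an integrable field. -/
lemma integral_comp_mul_diverg_le {d : ℕ} {v e : Euc d → ℝ} {F : Euc d → Euc d} {p : ℝ → ℝ}
    (hv : ContDiff ℝ 1 v) (hF : ContDiff ℝ 1 F) (hp : ContDiff ℝ 1 p) (hp1 : ∀ s, |p s| ≤ 1)
    (hFi : Integrable F) (hdiv : Integrable (diverg F)) (he : Integrable e)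
    (he0 : ∀ x, 0 ≤ e x) (hle : ∀ x, -(deriv p (v x) * fderiv ℝ v x (F x)) ≤ e x) :
    ∫ x, p (v x) * diverg F x ≤ ∫ x, e x := by
  obtain ⟨φ, C, hφ, hφc, hφ0, hφ1, hφlim, hφC⟩ := exists_cutoff d
  have hpv : ContDiff ℝ 1 (fun x => p (v x)) := hp.comp hv
  have hV : ContDiff ℝ 1 (fun x => p (v x) • F x) := hpv.smul hF
  have hdivc := continuous_diverg hF
  have hp' := hp.continuous_deriv le_rfl
  have hv' := hv.continuous_fderiv one_ne_zero
  have hbulk : Continuous (fun x => deriv p (v x) * fderiv ℝ v x (F x)) :=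
    (hp'.comp hv.continuous).mul (hv'.clm_apply hF.continuous)
  have hprod : ∀ x, diverg (fun y => p (v y) • F y) x =
      deriv p (v x) * fderiv ℝ v x (F x) + p (v x) * diverg F x := by
    intro x
    rw [diverg_smul (hpv.differentiable one_ne_zero x) (hF.differentiable one_ne_zero x)]
    have h := ((hp.differentiable one_ne_zero (v x)).hasDerivAt.comp_hasFDerivAt x
      (hv.differentiable one_ne_zero x).hasFDerivAt).fderiv
    have h' : (fun y => p (v y)) = p ∘ v := rfl
    rw [h', h]
    simp
  have hcut : ∀ n, ∫ x, φ n x * (p (v x) * diverg F x) ≤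
      1 / ((n : ℝ) + 1) * C * (∫ x, ‖F x‖) + ∫ x, e x := by
    intro n
    have i1 : Integrable (fun x => φ n x * (p (v x) * diverg F x)) :=
      (((hφ n).continuous.mul (hpv.continuous.mul hdivc)).integrable_of_hasCompactSupport
        (hφc n).mul_right)
    have i2 : Integrable (fun x => φ n x * (deriv p (v x) * fderiv ℝ v x (F x))) :=
      (((hφ n).continuous.mul hbulk).integrable_of_hasCompactSupport (hφc n).mul_right)
    have hibp := integral_mul_diverg_eq_neg (hφ n) (hφc n) hV
    simp_rw [hprod, mul_add] at hibp
    rw [integral_add i2 i1] at hibp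
    have b1 : -∫ x, fderiv ℝ (φ n) x (p (v x) • F x) ≤ 1 / ((n : ℝ) + 1) * C * ∫ x, ‖F x‖ := by
      rw [← integral_const_mul]
      refine (neg_le_abs _).trans ((Real.norm_eq_abs _).symm.trans_le
        (norm_integral_le_of_norm_le (hFi.norm.const_mul _) (.of_forall fun x => ?_)))
      refine ((fderiv ℝ (φ n) x).le_of_opNorm_le (hφC n x) _).trans ?_
      have hC0 : 0 ≤ 1 / ((n : ℝ) + 1) * C := (norm_nonneg _).trans (hφC n x)
      refine mul_le_mul_of_nonneg_left ?_ hC0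
      rw [norm_smul]
      exact mul_le_of_le_one_left (norm_nonneg _) (hp1 _)
    have b2 : -∫ x, φ n x * (deriv p (v x) * fderiv ℝ v x (F x)) ≤ ∫ x, e x := by
      rw [← integral_neg]
      refine integral_mono i2.neg he fun x => ?_
      have := hle x
      have := mul_le_mul_of_nonneg_left this (hφ0 n x)
      have := mul_le_of_le_one_left (he0 x) (hφ1 n x)
      linarith
    linarith
  have hdom : Filter.Tendsto (fun n => ∫ x, φ n x * (p (v x) * diverg F x)) Filter.atTop
      (nhds (∫ x, p (v x) * diverg F x)) := by
    refine tendsto_integral_of_dominated_convergence (fun x => ‖diverg F x‖)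
      (fun n => ((hφ n).continuous.mul (hpv.continuous.mul hdivc)).aestronglyMeasurable)
      hdiv.norm (fun n => .of_forall fun x => ?_) (.of_forall fun x => ?_)
    · rw [norm_mul, norm_mul, Real.norm_of_nonneg (hφ0 n x)]
      exact (mul_le_of_le_one_left (by positivity) (hφ1 n x)).trans
        (mul_le_of_le_one_left (norm_nonneg _) (hp1 _))
    · simpa using (hφlim x).mul_const (p (v x) * diverg F x)
  have hrhs : Filter.Tendsto (fun n : ℕ => 1 / ((n : ℝ) + 1) * C * (∫ x, ‖F x‖) + ∫ x, e x)
      Filter.atTop (nhds (∫ x, e x)) := by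
    have := ((tendsto_one_div_add_atTop_nhds_zero_nat (𝕜 := ℝ)).mul_const C).mul_const
      (∫ x, ‖F x‖)
    simpa using this.add_const (∫ x, e x)
  exact le_of_tendsto_of_tendsto' hdom hrhs hcut

/-- Smooth approximation of the absolute value, vanishing at zero. -/
def smoothAbs (δ s : ℝ) : ℝ := √(δ ^ 2 + s ^ 2) - δ

/-- Derivative of `smoothAbs`, a smooth approximation of the sign. -/
def smoothSign (δ s : ℝ) : ℝ := s / √(δ ^ 2 + s ^ 2)

section smoothAbs

variable {δ : ℝ}

lemma abs_le_sqrt_sq_add_sq (δ s : ℝ) : |s| ≤ √(δ ^ 2 + s ^ 2) :=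
  Real.abs_le_sqrt (by nlinarith [sq_nonneg δ])

lemma continuous_smoothAbs (δ : ℝ) : Continuous (smoothAbs δ) := by
  unfold smoothAbs; fun_prop

lemma contDiff_smoothSign (hδ : 0 < δ) : ContDiff ℝ 1 (smoothSign δ) := by
  have hpos : ∀ s : ℝ, 0 < δ ^ 2 + s ^ 2 := fun s => by positivity
  exact contDiff_id.div (((contDiff_const.add (contDiff_id.pow 2))).sqrt fun s => (hpos s).ne')
    fun s => (Real.sqrt_pos.2 (hpos s)).ne'

lemma hasDerivAt_sqrt_sq_add_sq (hδ : 0 < δ) (s : ℝ) :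
    HasDerivAt (fun s => √(δ ^ 2 + s ^ 2)) (smoothSign δ s) s := by
  have hpos : 0 < δ ^ 2 + s ^ 2 := by positivity
  have h := (((hasDerivAt_id s).pow 2).const_add (δ ^ 2)).sqrt hpos.ne'
  refine h.congr_deriv ?_
  have hr : √(δ ^ 2 + s ^ 2) ≠ 0 := (Real.sqrt_pos.2 hpos).ne'
  simp [smoothSign]
  field_simp

lemma hasDerivAt_smoothAbs (hδ : 0 < δ) (s : ℝ) :
    HasDerivAt (smoothAbs δ) (smoothSign δ s) s :=
  (hasDerivAt_sqrt_sq_add_sq hδ s).sub_const δ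

lemma deriv_smoothSign (hδ : 0 < δ) (s : ℝ) :
    deriv (smoothSign δ) s = δ ^ 2 / √(δ ^ 2 + s ^ 2) ^ 3 := by
  have hpos : 0 < δ ^ 2 + s ^ 2 := by positivity
  have hr : 0 < √(δ ^ 2 + s ^ 2) := Real.sqrt_pos.2 hpos
  have h := (hasDerivAt_id s).div (hasDerivAt_sqrt_sq_add_sq hδ s) hr.ne'
  have h' : deriv (smoothSign δ) s = _ := h.deriv
  rw [h']
  have hsq := Real.sq_sqrt hpos.le
  simp only [smoothSign, id]
  field_simp
  linarith

lemma deriv_smoothSign_nonneg (hδ : 0 < δ) (s : ℝ) : 0 ≤ deriv (smoothSign δ) s := by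
  rw [deriv_smoothSign hδ]; positivity

lemma abs_smoothSign_le_one (δ s : ℝ) : |smoothSign δ s| ≤ 1 := by
  rw [smoothSign, abs_div, abs_of_nonneg (Real.sqrt_nonneg _)]
  exact div_le_one_of_le₀ (abs_le_sqrt_sq_add_sq δ s) (Real.sqrt_nonneg _)

lemma abs_smoothAbs_le (hδ : 0 < δ) (s : ℝ) : |smoothAbs δ s| ≤ |s| := by
  have h1 : δ ≤ √(δ ^ 2 + s ^ 2) := Real.le_sqrt_of_sq_le (by nlinarith [sq_nonneg s])
  have h2 : √(δ ^ 2 + s ^ 2) ≤ δ + |s| :=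
    Real.sqrt_le_iff.2 ⟨by positivity, by nlinarith [sq_abs s, abs_nonneg s]⟩
  rw [smoothAbs, abs_of_nonneg (by linarith)]
  linarith

lemma deriv_smoothSign_mul_abs_le_one (hδ : 0 < δ) (s : ℝ) :
    deriv (smoothSign δ) s * |s| ≤ 1 := by
  have hpos : 0 < δ ^ 2 + s ^ 2 := by positivity
  have hr : 0 < √(δ ^ 2 + s ^ 2) := Real.sqrt_pos.2 hpos
  rw [deriv_smoothSign hδ, div_mul_eq_mul_div, div_le_one (by positivity), pow_succ _ 2]
  refine mul_le_mul ?_ (abs_le_sqrt_sq_add_sq δ s) (abs_nonneg s) (by positivity)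
  rw [Real.sq_sqrt hpos.le]
  nlinarith [sq_nonneg s]

lemma tendsto_smoothAbs (s : ℝ) :
    Filter.Tendsto (fun δ => smoothAbs δ s) (nhdsWithin 0 (Set.Ioi 0)) (nhds |s|) := by
  have hc : Continuous (fun δ => smoothAbs δ s) := by unfold smoothAbs; fun_prop
  have h := (hc.tendsto 0).mono_left (nhdsWithin_le_nhds (s := Set.Ioi 0))
  simpa [smoothAbs, Real.sqrt_sq_eq_abs] using h

lemma tendsto_deriv_smoothSign_mul_abs (s : ℝ) :
    Filter.Tendsto (fun δ => deriv (smoothSign δ) s * |s|) (nhdsWithin 0 (Set.Ioi 0))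
      (nhds 0) := by
  rcases eq_or_ne s 0 with rfl | hs
  · simp
  have hc : ContinuousAt (fun δ : ℝ => δ ^ 2 / √(δ ^ 2 + s ^ 2) ^ 3 * |s|) 0 := by
    have : √((0:ℝ) ^ 2 + s ^ 2) ^ 3 ≠ 0 :=
      (pow_pos (Real.sqrt_pos.2 (by positivity)) 3).ne'
    fun_prop (disch := assumption)
  have h := hc.tendsto.mono_left (nhdsWithin_le_nhds (s := Set.Ioi 0))
  simp only [ne_eq, OfNat.ofNat_ne_zero, not_false_eq_true, zero_pow, zero_div, zero_mul] at h
  refine h.congr' ?_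
  filter_upwards [self_mem_nhdsWithin] with δ hδ
  rw [deriv_smoothSign hδ]

end smoothAbs

lemma exists_bound_deriv_and_linear_growth {f : ℝ → ℝ} (hf : ContDiff ℝ 1 f) (hf0 : f 0 = 0)
    (M : ℝ) : ∃ L, 0 ≤ L ∧ ∀ s, |s| ≤ M → |deriv f s| ≤ L ∧ |f s| ≤ L * |s| := by
  obtain ⟨L, hL⟩ := (isCompact_Icc (a := -M) (b := M)).exists_bound_of_continuousOn
    (hf.continuous_deriv le_rfl).continuousOn
  refine ⟨|L|, abs_nonneg L, fun s hs => ?_⟩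
  have hs' := abs_le.1 hs
  have hM : 0 ≤ M := (abs_nonneg s).trans hs
  refine ⟨(hL s hs').trans (le_abs_self L), ?_⟩
  have h := (convex_Icc (-M) M).norm_image_sub_le_of_norm_deriv_le
    (fun x _ => hf.differentiable one_ne_zero x)
    (fun x hx => (hL x hx).trans (le_abs_self L)) (x := 0) (y := s) ⟨by linarith, hM⟩ hs'
  simpa [hf0] using h

theorem stmt_12 (d : ℕ) (hd : 1 ≤ d) (T : ℝ) (hT : 0 < T) (ε : ℝ) (hε : 0 ≤ ε)
    (f : ℝ → ℝ) (hf : ContDiff ℝ 1 f) (hf0 : f 0 = 0)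
    (W : ℝ → Euc d → Euc d)
    (hWc : ContinuousOn (fun p : ℝ × Euc d => W p.1 p.2) (Set.Icc 0 T ×ˢ Set.univ))
    (hWx : ∀ t ∈ Set.Icc (0:ℝ) T, ContDiff ℝ 1 (W t))
    (MW MD : ℝ)
    (hWb : ∀ t ∈ Set.Icc (0:ℝ) T, ∀ x, ‖W t x‖ ≤ MW)
    (hdivWb : ∀ t ∈ Set.Icc (0:ℝ) T, ∀ x, |diverg (W t) x| ≤ MD)
    (hdivWc : ContinuousOn (fun p : ℝ × Euc d => diverg (W p.1) p.2)
      (Set.Icc 0 T ×ˢ Set.univ))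
    (u ut : ℝ → Euc d → ℝ)
    (huc : ContinuousOn (fun p : ℝ × Euc d => u p.1 p.2) (Set.Icc 0 T ×ˢ Set.univ))
    (hut : ∀ t ∈ Set.Ioo (0:ℝ) T, ∀ x, HasDerivAt (fun τ => u τ x) (ut t x) t)
    (hux : ∀ t ∈ Set.Icc (0:ℝ) T, ContDiff ℝ 2 (u t))
    (hPDE : ∀ t ∈ Set.Ioo (0:ℝ) T, ∀ x,
      ut t x + deriv f (u t x) * ⟪gradient (u t) x, W t x⟫ + f (u t x) * diverg (W t) x
        = ε * lap (u t) x)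
    (Mu : ℝ) (hub : ∀ t ∈ Set.Icc (0:ℝ) T, ∀ x, |u t x| ≤ Mu)
    (g : Euc d → ℝ) (hg : Integrable g)
    (hdom : ∀ t ∈ Set.Icc (0:ℝ) T, ∀ x,
      |u t x| + ‖gradient (u t) x‖ + |lap (u t) x| ≤ g x) :
    AntitoneOn (fun t => ∫ x, |u t x|) (Set.Icc 0 T) := by
  have h0T : (0:ℝ) ∈ Set.Icc 0 T := ⟨le_rfl, hT.le⟩
  have hMW : 0 ≤ MW := (norm_nonneg _).trans (hWb 0 h0T 0)
  have hMD : 0 ≤ MD := (abs_nonneg _).trans (hdivWb 0 h0T 0)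
  have hg0 : ∀ x, 0 ≤ g x := fun x => le_trans (by positivity) (hdom 0 h0T x)
  obtain ⟨L, hL0, hL⟩ := exists_bound_deriv_and_linear_growth hf hf0 Mu
  have hug : ∀ t ∈ Set.Icc (0:ℝ) T, ∀ x, |u t x| ≤ g x := fun t ht x => by
    linarith [hdom t ht x, norm_nonneg (gradient (u t) x), abs_nonneg (lap (u t) x)]
  have hgradg : ∀ t ∈ Set.Icc (0:ℝ) T, ∀ x, ‖gradient (u t) x‖ ≤ g x := fun t ht x => by
    linarith [hdom t ht x, abs_nonneg (u t x), abs_nonneg (lap (u t) x)]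
  have hlapg : ∀ t ∈ Set.Icc (0:ℝ) T, ∀ x, |lap (u t) x| ≤ g x := fun t ht x => by
    linarith [hdom t ht x, norm_nonneg (gradient (u t) x), abs_nonneg (u t x)]
  have huct : ∀ t ∈ Set.Icc (0:ℝ) T, Continuous (u t) := fun t ht => (hux t ht).continuous
  let F : ℝ → Euc d → Euc d := fun t x => ε • gradient (u t) x + (-f (u t x)) • W t x
  have hF : ∀ t ∈ Set.Icc (0:ℝ) T, ContDiff ℝ 1 (F t) := fun t ht => by
    have hgrad := contDiff_gradient (hux t ht)
    have hu1 := (hux t ht).of_le one_le_two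
    have hW1 := hWx t ht
    simp only [F]
    fun_prop
  have hdivF : ∀ t ∈ Set.Ioo (0:ℝ) T, ∀ x, diverg (F t) x = ut t x := by
    intro t ht x
    have ht' := Set.Ioo_subset_Icc_self ht
    have hgrad := (contDiff_gradient (hux t ht')).differentiable one_ne_zero x
    have hu1 := (hux t ht').differentiable two_ne_zero x
    have hfu : HasFDerivAt (fun y => -f (u t y)) (-(deriv f (u t x) • fderiv ℝ (u t) x)) x :=
      ((hf.differentiable one_ne_zero (u t x)).hasDerivAt.comp_hasFDerivAt x
        hu1.hasFDerivAt).neg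
    have hWd := (hWx t ht').differentiable one_ne_zero x
    have h := hPDE t ht x
    simp only [F]
    rw [diverg_add (hgrad.fun_const_smul ε) (hfu.differentiableAt.fun_smul hWd),
      diverg_smul (differentiableAt_const ε) hgrad, diverg_smul hfu.differentiableAt hWd,
      hfu.fderiv, diverg_gradient (hux t ht'), ← sub_eq_zero]
    rw [inner_gradient_left] at h
    simp
    linarith
  have hfW : ∀ t ∈ Set.Icc (0:ℝ) T, ∀ x, ‖f (u t x) • W t x‖ ≤ L * MW * |u t x| := by
    intro t ht x
    rw [norm_smul]
    calc ‖f (u t x)‖ * ‖W t x‖ ≤ (L * |u t x|) * MW :=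
          mul_le_mul (hL _ (hub t ht x)).2 (hWb t ht x) (norm_nonneg _) (by positivity)
      _ = L * MW * |u t x| := by ring
  have hFg : ∀ t ∈ Set.Icc (0:ℝ) T, ∀ x, ‖F t x‖ ≤ (ε + L * MW) * g x := by
    intro t ht x
    have h1 : ‖ε • gradient (u t) x‖ ≤ ε * g x := by
      rw [norm_smul, Real.norm_of_nonneg hε]
      exact mul_le_mul_of_nonneg_left (hgradg t ht x) hε
    have h2 := (hfW t ht x).trans
      (mul_le_mul_of_nonneg_left (hug t ht x) (mul_nonneg hL0 hMW))
    rw [add_mul]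
    refine (norm_add_le _ _).trans (add_le_add h1 ?_)
    rwa [neg_smul, norm_neg]
  set K := ε + L * MW + L * MD with hK
  have hutg : ∀ t ∈ Set.Ioo (0:ℝ) T, ∀ x, |ut t x| ≤ K * g x := by
    intro t ht x
    have ht' := Set.Ioo_subset_Icc_self ht
    have h1 : |ε * lap (u t) x| ≤ ε * g x := by
      rw [abs_mul, abs_of_nonneg hε]
      exact mul_le_mul_of_nonneg_left (hlapg t ht' x) hε
    have h2 : |deriv f (u t x) * ⟪gradient (u t) x, W t x⟫| ≤ L * (g x * MW) := by
      rw [abs_mul]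
      exact mul_le_mul (hL _ (hub t ht' x)).1 ((abs_real_inner_le_norm _ _).trans
        (mul_le_mul (hgradg t ht' x) (hWb t ht' x) (norm_nonneg _) (hg0 x)))
        (abs_nonneg _) hL0
    have h3 : |f (u t x) * diverg (W t) x| ≤ L * g x * MD := by
      rw [abs_mul]
      exact mul_le_mul ((hL _ (hub t ht' x)).2.trans
        (mul_le_mul_of_nonneg_left (hug t ht' x) hL0)) (hdivWb t ht' x) (abs_nonneg _)
        (mul_nonneg hL0 (hg0 x))
    have h4 := hPDE t ht x
    rw [abs_le] at *
    rw [hK]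
    constructor <;> linarith
  have hutc : ∀ t ∈ Set.Ioo (0:ℝ) T, Continuous (ut t) := fun t ht => by
    have := continuous_diverg (hF t (Set.Ioo_subset_Icc_self ht))
    rwa [funext (hdivF t ht)] at this
  have hsu : ∀ δ, 0 < δ → ∀ t ∈ Set.Ioo (0:ℝ) T, ∀ x,
      ‖smoothSign δ (u t x) * ut t x‖ ≤ K * g x := fun δ _ t ht x => by
    rw [norm_mul]
    exact (mul_le_of_le_one_left (norm_nonneg _) (abs_smoothSign_le_one _ _)).trans
      (hutg t ht x)
  let Φ : ℝ → ℝ → ℝ := fun δ t => ∫ x, smoothAbs δ (u t x)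
  have hΦc : ∀ δ, 0 < δ → ContinuousOn (Φ δ) (Set.Icc 0 T) := by
    intro δ hδ
    refine continuousOn_of_dominated (bound := g)
      (fun t ht => ((continuous_smoothAbs δ).comp (huct t ht)).aestronglyMeasurable)
      (fun t ht => .of_forall fun x => (abs_smoothAbs_le hδ _).trans (hug t ht x)) hg
      (.of_forall fun x => ?_)
    refine (continuous_smoothAbs δ).comp_continuousOn ?_
    exact huc.comp (f := fun t => (t, x)) (by fun_prop) fun t ht => ⟨ht, Set.mem_univ x⟩
  have hΦd : ∀ δ, 0 < δ → ∀ t ∈ Set.Ioo (0:ℝ) T,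
      HasDerivAt (Φ δ) (∫ x, smoothSign δ (u t x) * ut t x) t := by
    intro δ hδ t ht
    have ht' := Set.Ioo_subset_Icc_self ht
    have hnhds := Ioo_mem_nhds ht.1 ht.2
    refine (hasDerivAt_integral_of_dominated_loc_of_deriv_le (bound := fun x => K * g x)
      (F := fun t x => smoothAbs δ (u t x)) (F' := fun t x => smoothSign δ (u t x) * ut t x) hnhds ?_ ?_ ?_ ?_ (hg.const_mul K) ?_).2
    · filter_upwards [hnhds] with s hs
      exact ((continuous_smoothAbs δ).comp
        (huct s (Set.Ioo_subset_Icc_self hs))).aestronglyMeasurable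
    · exact hg.mono' ((continuous_smoothAbs δ).comp (huct t ht')).aestronglyMeasurable
        (.of_forall fun x => (abs_smoothAbs_le hδ _).trans (hug t ht' x))
    · exact (((contDiff_smoothSign hδ).continuous.comp (huct t ht')).mul
        (hutc t ht)).aestronglyMeasurable
    · exact .of_forall fun x s hs => hsu δ hδ s hs x
    · exact .of_forall fun x s hs => (hasDerivAt_smoothAbs hδ _).comp s (hut s hs x)
  have hDb : ∀ δ, 0 < δ → ∀ t ∈ Set.Ioo (0:ℝ) T,
      |∫ x, smoothSign δ (u t x) * ut t x| ≤ ∫ x, K * g x := fun δ hδ t ht =>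
    (Real.norm_eq_abs _).symm.trans_le
      (norm_integral_le_of_norm_le (hg.const_mul K) (.of_forall (hsu δ hδ t ht)))
  let e : ℝ → ℝ → Euc d → ℝ := fun δ t x =>
    L * MW * (deriv (smoothSign δ) (u t x) * |u t x| * g x)
  have he0 : ∀ δ, 0 < δ → ∀ t x, 0 ≤ e δ t x := fun δ hδ t x =>
    mul_nonneg (mul_nonneg hL0 hMW) (mul_nonneg
      (mul_nonneg (deriv_smoothSign_nonneg hδ _) (abs_nonneg _)) (hg0 x))
  have heg : ∀ δ, 0 < δ → ∀ t x, e δ t x ≤ L * MW * g x := fun δ hδ t x =>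
    mul_le_mul_of_nonneg_left
      (mul_le_of_le_one_left (hg0 x) (deriv_smoothSign_mul_abs_le_one hδ _))
      (mul_nonneg hL0 hMW)
  have hem : ∀ δ, 0 < δ → ∀ t ∈ Set.Icc (0:ℝ) T, AEStronglyMeasurable (e δ t) :=
    fun δ hδ t ht => AEStronglyMeasurable.const_mul
      (((((contDiff_smoothSign hδ).continuous_deriv le_rfl).comp (huct t ht)).mul
        (huct t ht).abs).aestronglyMeasurable.mul hg.1) _
  have heb : ∀ δ, 0 < δ → ∀ t x, ‖e δ t x‖ ≤ L * MW * g x := fun δ hδ t x => by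
    rw [Real.norm_of_nonneg (he0 δ hδ t x)]
    exact heg δ hδ t x
  have hDe : ∀ δ, 0 < δ → ∀ t ∈ Set.Ioo (0:ℝ) T,
      ∫ x, smoothSign δ (u t x) * ut t x ≤ ∫ x, e δ t x := by
    intro δ hδ t ht
    have ht' := Set.Ioo_subset_Icc_self ht
    have hFi : Integrable (F t) := (hg.const_mul (ε + L * MW)).mono'
      (hF t ht').continuous.aestronglyMeasurable (.of_forall (hFg t ht'))
    have hdivi : Integrable (diverg (F t)) := by
      rw [funext (hdivF t ht)]
      exact (hg.const_mul K).mono' (hutc t ht).aestronglyMeasurable (.of_forall (hutg t ht))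
    have hei : Integrable (e δ t) := (hg.const_mul (L * MW)).mono' (hem δ hδ t ht')
      (.of_forall (heb δ hδ t))
    have h := integral_comp_mul_diverg_le ((hux t ht').of_le one_le_two) (hF t ht')
      (contDiff_smoothSign hδ) (abs_smoothSign_le_one δ) hFi hdivi hei (he0 δ hδ t) ?_
    · simpa only [hdivF t ht] using h
    intro x
    have h1 : -fderiv ℝ (u t) x (F t x) ≤ L * MW * |u t x| * g x := by
      rw [← inner_gradient_left]
      simp only [F, inner_add_right, inner_smul_right, real_inner_self_eq_norm_sq]
      have h2 := (real_inner_le_norm (gradient (u t) x) (f (u t x) • W t x)).trans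
        (mul_le_mul (hgradg t ht' x) (hfW t ht' x) (norm_nonneg _) (hg0 x))
      rw [inner_smul_right] at h2
      have h3 : 0 ≤ ε * ‖gradient (u t) x‖ ^ 2 := by positivity
      linarith
    have h2 := mul_le_mul_of_nonneg_left h1 (deriv_smoothSign_nonneg hδ (u t x))
    simp only [e]
    linarith
  have helim : ∀ t ∈ Set.Icc (0:ℝ) T, Filter.Tendsto (fun δ => ∫ x, e δ t x)
      (nhdsWithin 0 (Set.Ioi 0)) (nhds 0) := by
    intro t ht
    suffices Filter.Tendsto (fun δ => ∫ x, e δ t x) (nhdsWithin 0 (Set.Ioi 0))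
        (nhds (∫ _ : Euc d, (0:ℝ))) by simpa only [integral_zero] using this
    refine tendsto_integral_filter_of_dominated_convergence (fun x => L * MW * g x) ?_ ?_
      (hg.const_mul _) (.of_forall fun x => ?_)
    · filter_upwards [self_mem_nhdsWithin] with δ hδ using hem δ hδ t ht
    · filter_upwards [self_mem_nhdsWithin] with δ hδ using .of_forall (heb δ hδ t)
    · simpa using ((tendsto_deriv_smoothSign_mul_abs (u t x)).mul_const (g x)).const_mul (L * MW)
  have hΦlim : ∀ t ∈ Set.Icc (0:ℝ) T, Filter.Tendsto (fun δ => Φ δ t)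
      (nhdsWithin 0 (Set.Ioi 0)) (nhds (∫ x, |u t x|)) := by
    intro t ht
    refine tendsto_integral_filter_of_dominated_convergence g ?_ ?_ hg
      (.of_forall fun x => tendsto_smoothAbs (u t x))
    · exact .of_forall fun δ => ((continuous_smoothAbs δ).comp (huct t ht)).aestronglyMeasurable
    · filter_upwards [self_mem_nhdsWithin] with δ hδ using
        .of_forall fun x => (abs_smoothAbs_le hδ _).trans (hug t ht x)
  let G : ℝ → ℝ → ℝ := fun δ => (Set.Ioo 0 T).indicator (deriv (Φ δ))
  have hGm : ∀ δ, Measurable (G δ) := fun δ => (measurable_deriv _).indicator measurableSet_Ioo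
  have hC0 : 0 ≤ ∫ x, K * g x := integral_nonneg fun x => mul_nonneg (by positivity) (hg0 x)
  have hGb : ∀ δ, 0 < δ → ∀ t, |G δ t| ≤ ∫ x, K * g x := by
    intro δ hδ t
    by_cases ht : t ∈ Set.Ioo (0:ℝ) T
    · simp only [G, Set.indicator_of_mem ht, (hΦd δ hδ t ht).deriv]
      exact hDb δ hδ t ht
    · simpa only [G, Set.indicator_of_notMem ht, abs_zero] using hC0
  have hGmax : ∀ δ, 0 < δ → ∀ t, |max (G δ t) 0| ≤ ∫ x, K * g x := fun δ hδ t => by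
    rw [abs_of_nonneg (le_max_right _ _)]
    exact max_le ((le_abs_self _).trans (hGb δ hδ t)) hC0
  have hGlim : ∀ t, Filter.Tendsto (fun δ => max (G δ t) 0) (nhdsWithin 0 (Set.Ioi 0))
      (nhds 0) := by
    intro t
    by_cases ht : t ∈ Set.Ioo (0:ℝ) T
    · refine tendsto_of_tendsto_of_tendsto_of_le_of_le' tendsto_const_nhds
        (helim t (Set.Ioo_subset_Icc_self ht)) (.of_forall fun δ => le_max_right _ _) ?_
      filter_upwards [self_mem_nhdsWithin] with δ hδ
      simp only [G, Set.indicator_of_mem ht, (hΦd δ hδ t ht).deriv]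
      exact max_le (hDe δ hδ t ht) (integral_nonneg (he0 δ hδ t))
    · simp only [G, Set.indicator_of_notMem ht, max_self]
      exact tendsto_const_nhds
  intro a ha b hb hab
  have hint : ∀ h : ℝ → ℝ, Measurable h → (∀ t, |h t| ≤ ∫ x, K * g x) →
      IntervalIntegrable h volume a b := fun h hm hbd =>
    (intervalIntegrable_const (c := ∫ x, K * g x)).mono_fun' hm.aestronglyMeasurable
      (.of_forall hbd)
  have hlim : Filter.Tendsto (fun δ => ∫ t in a..b, max (G δ t) 0) (nhdsWithin 0 (Set.Ioi 0))
      (nhds 0) := by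
    suffices Filter.Tendsto (fun δ => ∫ t in a..b, max (G δ t) 0) (nhdsWithin 0 (Set.Ioi 0))
        (nhds (∫ _ in a..b, (0:ℝ))) by simpa only [intervalIntegral.integral_zero] using this
    refine intervalIntegral.tendsto_integral_filter_of_dominated_convergence
      (fun _ => ∫ x, K * g x) (.of_forall fun δ =>
        ((hGm δ).max measurable_const).aestronglyMeasurable) ?_ intervalIntegrable_const
      (.of_forall fun t _ => hGlim t)
    filter_upwards [self_mem_nhdsWithin] with δ hδ using .of_forall fun t _ => hGmax δ hδ t
  have hfin := le_of_tendsto_of_tendsto ((hΦlim b hb).sub (hΦlim a ha)) hlim ?_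
  · simpa using hfin
  filter_upwards [self_mem_nhdsWithin] with δ hδ
  rw [← intervalIntegral.integral_eq_sub_of_hasDerivAt_of_le hab
    ((hΦc δ hδ).mono (Set.Icc_subset_Icc ha.1 hb.2)) (f' := G δ) ?_ (hint _ (hGm δ) (hGb δ hδ))]
  · exact intervalIntegral.integral_mono_on hab (hint _ (hGm δ) (hGb δ hδ))
      (hint _ ((hGm δ).max measurable_const) (hGmax δ hδ)) fun t _ => le_max_left _ _
  · intro t ht
    have ht' : t ∈ Set.Ioo (0:ℝ) T := ⟨ha.1.trans_lt ht.1, ht.2.trans_le hb.2⟩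
    simpa only [G, Set.indicator_of_mem ht'] using (hΦd δ hδ t ht').differentiableAt.hasDerivAt
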